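/- arXiv:1510.04667 — 6 statements merged into one kernel-verified Lean document; each statement's English description precedes it below -/
import Mathlib

section
/- Let B be a translation invariant differentiation basis on ℝ² and let f ∈ L¹(ℝ²). Then the set W_B(f) = {γ ∈ Γ₂ : the integral of f is not differentiable with respect to the rotated basis B(γ)} is of type G_δσ in Γ₂ (i.e., it is a countable union of countable intersections of open subsets of the circle Γ₂). -/
open MeasureTheory Filter Set Topology

noncomputable section

/-- A differentiation basis on the plane (identified with `ℂ`): to each point `x` it assigns a
family of bounded measurable sets of positive measure containing `x`, admitting a sequence of
sets whose diameters tend to `0`. -/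
structure DiffBasis where
  sets : ℂ → Set (Set ℂ)
  bounded : ∀ x, ∀ R ∈ sets x, Bornology.IsBounded R
  measurable : ∀ x, ∀ R ∈ sets x, MeasurableSet R
  pos_measure : ∀ x, ∀ R ∈ sets x, 0 < volume R
  mem_self : ∀ x, ∀ R ∈ sets x, x ∈ R
  shrink : ∀ x, ∃ Rk : ℕ → Set ℂ, (∀ k, Rk k ∈ sets x) ∧
    Tendsto (fun k => Metric.diam (Rk k)) atTop (nhds 0)

/-- Translation invariance of a differentiation basis. -/
def DiffBasis.TI (B : DiffBasis) : Prop :=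
  ∀ x, B.sets x = (fun R => (fun y => x + y) '' R) '' B.sets 0

/-- The `γ`-rotated family of a set family: each `R ∈ S x` is rotated by `γ` around `x`. -/
def rotSets (S : ℂ → Set (Set ℂ)) (γ : Circle) : ℂ → Set (Set ℂ) :=
  fun x => (fun R => (fun y => x + (γ : ℂ) * (y - x)) '' R) '' S x

/-- The filter of "sets from the family with diameter tending to zero". -/
def basisFilter (F : Set (Set ℂ)) : Filter (Set ℂ) :=
  ⨅ r : {r : ℝ // 0 < r}, Filter.principal {R ∈ F | Metric.diam R < r.1}

/-- The average `(1/|R|) ∫_R f`. -/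
def avgI (f : ℂ → ℝ) (R : Set ℂ) : ℝ := (volume R).toReal⁻¹ * ∫ z in R, f z

/-- The upper derivative of `∫ f` with respect to the family `S` at `x`. -/
def upperD (S : ℂ → Set (Set ℂ)) (f : ℂ → ℝ) (x : ℂ) : EReal :=
  Filter.limsup (fun R => ((avgI f R : ℝ) : EReal)) (basisFilter (S x))

/-- The lower derivative of `∫ f` with respect to the family `S` at `x`. -/
def lowerD (S : ℂ → Set (Set ℂ)) (f : ℂ → ℝ) (x : ℂ) : EReal :=
  Filter.liminf (fun R => ((avgI f R : ℝ) : EReal)) (basisFilter (S x))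

/-- `∫ f` is differentiable with respect to the family `S`. -/
def Differentiates (S : ℂ → Set (Set ℂ)) (f : ℂ → ℝ) : Prop :=
  ∀ᵐ x : ℂ, upperD S f x = ((f x : ℝ) : EReal) ∧ lowerD S f x = ((f x : ℝ) : EReal)

/-- The open unit square `(0,1)²`. -/
def unitSquare : Set ℂ := {z | z.re ∈ Set.Ioo (0:ℝ) 1 ∧ z.im ∈ Set.Ioo (0:ℝ) 1}

/-- The rigid motion `y ↦ x + γ y`. -/
def rigid (γ : Circle) (x : ℂ) (y : ℂ) : ℂ := x + (γ : ℂ) * y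

lemma rigid_mp (γ : Circle) (x : ℂ) : MeasurePreserving (rigid γ x) volume volume :=
  (measurePreserving_add_left volume x).comp (rotation γ).measurePreserving

lemma rigid_isom (γ : Circle) (x : ℂ) : Isometry (rigid γ x) :=
  (isometry_add_left x).comp (rotation γ).isometry

lemma rigid_emb (γ : Circle) (x : ℂ) : MeasurableEmbedding (rigid γ x) :=
  (rigid_isom γ x).isClosedEmbedding.measurableEmbedding

/-- The average of `f` over the moved set `x + γ R`, in pulled-back form. -/
def pavg (f : ℂ → ℝ) (R : Set ℂ) (γ : Circle) (x : ℂ) : ℝ :=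
  (volume R).toReal⁻¹ * ∫ y in R, f (rigid γ x y)

lemma avgI_rigid (f : ℂ → ℝ) (R : Set ℂ) (γ : Circle) (x : ℂ) :
    avgI f (rigid γ x '' R) = pavg f R γ x := by
  unfold avgI pavg
  rw [(rigid_mp γ x).setIntegral_image_emb (rigid_emb γ x)]
  congr 3
  have h := (rigid_mp γ x).measure_preimage_emb (rigid_emb γ x) (rigid γ x '' R)
  rw [preimage_image_eq _ (rigid_isom γ x).injective] at h
  exact h.symm

lemma pavg_cont (f : ℂ → ℝ) (hf : Integrable f) (R : Set ℂ) :
    Continuous (fun p : Circle × ℂ => pavg f R p.1 p.2) := by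
  have hF : MemLp f 1 (volume : Measure ℂ) := memLp_one_iff_integrable.2 hf
  let g : C(Circle × ℂ, C(ℂ, ℂ)) := ContinuousMap.curry
    ⟨fun q : (Circle × ℂ) × ℂ => rigid q.1.1 q.1.2 q.2, by unfold rigid; fun_prop⟩
  have hgm : ∀ z, MeasurePreserving (g z) (volume : Measure ℂ) volume :=
    fun z => rigid_mp z.1 z.2
  have hc := Continuous.compMeasurePreservingLp (μ := (volume : Measure ℂ))
    (f := fun _ : Circle × ℂ => hF.toLp f) continuous_const g.continuous hgm
    ENNReal.one_ne_top
  have h2 := (continuous_setIntegral (μ := (volume : Measure ℂ)) (E := ℝ) R).comp hc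
  unfold pavg
  refine continuous_const.mul (h2.congr fun z => ?_)
  simp only [Function.comp]
  rw [Lp.toLp_compMeasurePreserving hF (hgm z)]
  exact integral_congr_ae (ae_restrict_of_ae (MemLp.coeFn_toLp _))

lemma rot_sets_eq (B : DiffBasis) (hB : B.TI) (γ : Circle) (x : ℂ) :
    rotSets B.sets γ x = (fun R => rigid γ x '' R) '' B.sets 0 := by
  unfold rotSets
  rw [hB x, image_image]
  refine image_congr fun R _ => ?_
  rw [image_image]
  refine image_congr fun y _ => ?_
  simp [rigid]

lemma basisFilter_hasBasis (F : Set (Set ℂ)) :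
    (basisFilter F).HasBasis (fun r : ℝ => 0 < r) (fun r => {R ∈ F | Metric.diam R < r}) := by
  constructor
  intro t
  unfold basisFilter
  haveI : Nonempty {r : ℝ // 0 < r} := ⟨⟨1, one_pos⟩⟩
  rw [mem_iInf_of_directed]
  · simp
  · intro a b
    refine ⟨⟨min a.1 b.1, lt_min a.2 b.2⟩, ?_, ?_⟩
    · exact principal_mono.2 fun R hR => ⟨hR.1, hR.2.trans_le (min_le_left _ _)⟩
    · exact principal_mono.2 fun R hR => ⟨hR.1, hR.2.trans_le (min_le_right _ _)⟩

/-- The exceptional set at scale `n` and height `k`. -/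
def badSet (B : DiffBasis) (f : ℂ → ℝ) (k n : ℕ) (γ : Circle) : Set ℂ :=
  {x | ∃ R ∈ B.sets 0, Metric.diam R < 1 / ((n : ℝ) + 1) ∧
    1 / ((k : ℝ) + 1) < |pavg f R γ x - f x|}

lemma deriv_iff (B : DiffBasis) (hB : B.TI) (f : ℂ → ℝ) (γ : Circle) (x : ℂ) :
    (upperD (rotSets B.sets γ) f x = ((f x : ℝ) : EReal) ∧
      lowerD (rotSets B.sets γ) f x = ((f x : ℝ) : EReal)) ↔
    ¬ ∃ k, x ∈ ⋂ n, badSet B f k n γ := by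
  have hb := basisFilter_hasBasis (rotSets B.sets γ x)
  have hne : (basisFilter (rotSets B.sets γ x)).NeBot := by
    rw [hb.neBot_iff]
    intro r hr
    obtain ⟨Rk, h1, h2⟩ := B.shrink 0
    obtain ⟨k, hk⟩ := (h2.eventually (gt_mem_nhds hr)).exists
    refine ⟨rigid γ x '' Rk k, ?_, ?_⟩
    · rw [rot_sets_eq B hB]
      exact mem_image_of_mem _ (h1 k)
    · rw [(rigid_isom γ x).diam_image]
      exact hk
  have h1 : (upperD (rotSets B.sets γ) f x = ((f x : ℝ) : EReal) ∧
      lowerD (rotSets B.sets γ) f x = ((f x : ℝ) : EReal)) ↔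
      Tendsto (avgI f) (basisFilter (rotSets B.sets γ x)) (𝓝 (f x)) := by
    rw [← EReal.tendsto_coe]
    constructor
    · rintro ⟨h, h'⟩
      exact tendsto_of_liminf_eq_limsup h' h
    · intro h
      exact ⟨h.limsup_eq, h.liminf_eq⟩
  rw [h1, hb.tendsto_iff Metric.nhds_basis_ball, rot_sets_eq B hB]
  simp only [mem_iInter, badSet, mem_setOf_eq, Metric.mem_ball, Real.dist_eq]
  push Not
  constructor
  · intro h k
    obtain ⟨r, hr, h⟩ := h (1 / ((k : ℝ) + 1)) (by positivity)
    obtain ⟨n, hn⟩ := exists_nat_one_div_lt hr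
    refine ⟨n, fun R hR hd => ?_⟩
    have := h (rigid γ x '' R) ⟨mem_image_of_mem _ hR, by
      rw [(rigid_isom γ x).diam_image]; exact hd.trans hn⟩
    rw [avgI_rigid] at this
    exact this.le
  · intro h ε hε
    obtain ⟨k, hk⟩ := exists_nat_one_div_lt hε
    obtain ⟨n, hn⟩ := h k
    refine ⟨1 / ((n : ℝ) + 1), by positivity, ?_⟩
    rintro _ ⟨⟨R, hR, rfl⟩, hd⟩
    simp only [(rigid_isom γ x).diam_image] at hd
    simp only [avgI_rigid]
    exact (hn R hR hd).trans_lt hk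

lemma badSet_nullMeas (B : DiffBasis) (f : ℂ → ℝ) (hf : Integrable f) (k n : ℕ) (γ : Circle) :
    NullMeasurableSet (badSet B f k n γ) volume := by
  have key : badSet B f k n γ = ⋃ q : ℚ × ℚ,
      ((⋃ R ∈ {R ∈ B.sets 0 | Metric.diam R < 1 / ((n : ℝ) + 1)},
        {x | |pavg f R γ x - q.1| < q.2}) ∩
      f ⁻¹' {t | 1 / ((k : ℝ) + 1) + q.2 < |t - q.1|}) := by
    ext x
    simp only [badSet, mem_setOf_eq, mem_iUnion, mem_inter_iff, mem_preimage, exists_prop]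
    constructor
    · rintro ⟨R, hR, hd, h⟩
      obtain ⟨δ, hδ0, hδ⟩ := exists_rat_btwn
        (show (0 : ℝ) < (|pavg f R γ x - f x| - 1 / ((k : ℝ) + 1)) / 2 by linarith)
      obtain ⟨p, hp1, hp2⟩ := exists_rat_btwn
        (show pavg f R γ x < pavg f R γ x + δ by linarith)
      have h3 : |pavg f R γ x - p| < δ := by
        rw [abs_lt]; constructor <;> linarith
      refine ⟨(p, δ), ⟨R, ⟨hR, hd⟩, h3⟩, ?_⟩
      have h4 := abs_sub_le (pavg f R γ x) p (f x)
      rw [abs_sub_comm (p : ℝ) (f x)] at h4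
      simp only
      linarith
    · rintro ⟨⟨p, δ⟩, ⟨R, ⟨hR, hd⟩, h3⟩, h4⟩
      refine ⟨R, hR, hd, ?_⟩
      have h5 := abs_sub_le (f x) (pavg f R γ x) p
      rw [abs_sub_comm (f x) (pavg f R γ x)] at h5
      simp only at h3 h4
      linarith
  rw [key]
  refine NullMeasurableSet.iUnion fun q => NullMeasurableSet.inter ?_ ?_
  · refine (IsOpen.measurableSet ?_).nullMeasurableSet
    refine isOpen_biUnion fun R _ => ?_
    have hc : Continuous (fun x => pavg f R γ x) :=
      (pavg_cont f hf R).comp (by fun_prop : Continuous fun x : ℂ => (γ, x))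
    exact isOpen_lt (by fun_prop) continuous_const
  · refine hf.aestronglyMeasurable.aemeasurable.nullMeasurable ?_
    exact (isOpen_lt continuous_const (by fun_prop)).measurableSet

lemma badSet_open (B : DiffBasis) (f : ℂ → ℝ) (hf : Integrable f) (k n : ℕ)
    (μ : Measure ℂ) (c : ENNReal) : IsOpen {γ : Circle | c < μ (badSet B f k n γ)} := by
  rw [← isClosed_compl_iff]
  refine IsSeqClosed.isClosed fun u γ hu hlim => ?_
  simp only [mem_compl_iff, mem_setOf_eq, not_lt] at hu ⊢
  have hsub : badSet B f k n γ ⊆ ⋃ N : ℕ, ⋂ j : ℕ, ⋂ _ : N ≤ j, badSet B f k n (u j) := by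
    rintro x ⟨R, hR, hd, h⟩
    have hc : Continuous (fun γ => |pavg f R γ x - f x|) := by
      have : Continuous (fun γ => pavg f R γ x) :=
        (pavg_cont f hf R).comp (by fun_prop : Continuous fun γ : Circle => (γ, x))
      fun_prop
    have he := ((hc.tendsto γ).comp hlim).eventually (lt_mem_nhds h)
    obtain ⟨N, hN⟩ := eventually_atTop.1 he
    simp only [mem_iUnion, mem_iInter]
    exact ⟨N, fun j hj => ⟨R, hR, hd, hN j hj⟩⟩
  refine (measure_mono hsub).trans ?_
  rw [Monotone.measure_iUnion]
  · refine iSup_le fun N => (measure_mono ?_).trans (hu N)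
    exact iInter₂_subset N le_rfl
  · intro a b hab x hx
    simp only [mem_iInter] at hx ⊢
    exact fun j hj => hx j (hab.trans hj)

/-- for a translation invariant basis `B` on the plane and `f ∈ L¹`, the set of
rotations `γ` for which `∫ f` is not differentiable with respect to `B(γ)` is of type `G_δσ`. -/
theorem Wset_of_TI_basis_is_Gdeltasigma (B : DiffBasis) (hB : B.TI)
    (f : ℂ → ℝ) (hf : Integrable f) :
    ∃ S : ℕ → Set Circle, (∀ n, IsGδ (S n)) ∧
      {γ : Circle | ¬ Differentiates (rotSets B.sets γ) f} = ⋃ n, S n := by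
  set μ : Measure ℂ := (volume : Measure ℂ).toFinite with hμ
  refine ⟨fun j => ⋂ n : ℕ, {γ : Circle |
    ((j.unpair.2 : ℕ) : ENNReal)⁻¹ < μ (badSet B f j.unpair.1 n γ)}, fun j => ?_, ?_⟩
  · exact IsGδ.iInter_of_isOpen fun n => badSet_open B f hf _ n μ _
  · ext γ
    have h1 : ¬ Differentiates (rotSets B.sets γ) f ↔
        ∃ k, μ (⋂ n, badSet B f k n γ) ≠ 0 := by
      unfold Differentiates
      simp only [deriv_iff B hB, not_exists, ae_all_iff]
      push Not
      refine exists_congr fun k => ?_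
      rw [ne_eq, hμ, toFinite_apply_eq_zero_iff, measure_eq_zero_iff_ae_notMem]
      rfl
    rw [mem_setOf_eq, h1]
    simp only [mem_iUnion, mem_iInter, mem_setOf_eq]
    constructor
    · rintro ⟨k, hk⟩
      obtain ⟨m, hm⟩ := ENNReal.exists_inv_nat_lt hk
      refine ⟨Nat.pair k m, fun n => ?_⟩
      rw [Nat.unpair_pair]
      exact hm.trans_le (measure_mono (iInter_subset _ n))
    · rintro ⟨j, hj⟩
      refine ⟨j.unpair.1, ?_⟩
      have ht := tendsto_measure_iInter_atTop (μ := μ)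
        (s := fun n => badSet B f j.unpair.1 n γ)
        (fun n => (badSet_nullMeas B f hf _ n γ).mono_ac (toFinite_absolutelyContinuous _))
        (by
          intro a b hab x
          rintro ⟨R, hR, hd, h⟩
          exact ⟨R, hR, hd.trans_le (Nat.one_div_le_one_div hab), h⟩)
        ⟨0, measure_ne_top _ _⟩
      have := ge_of_tendsto' ht (fun n => (hj n).le)
      refine (lt_of_lt_of_le ?_ this).ne'
      simp

end
end

section
/- Let B and H be differentiation bases on ℝ² with B(x) ⊆ H(x) for every x, and let (E_k)_{k∈N} be a nonempty finite or countable family of subsets of Γ₂ each of which is an R_{B,H}-set. Then the union ⋃_{k∈N} E_k is a W_{B,H}-set; that is, there exists f ∈ L¹(ℝ²) such that f ∉ F_{B(γ)} for every γ ∈ ⋃_{k∈N} E_k, and f ∈ F_{H(γ)} for every γ ∉ ⋃_{k∈N} E_k. -/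
open MeasureTheory Filter Set Topology

noncomputable section

/-- `E ⊆ Γ₂` is an `R_{B,H}`-set. -/
def IsRSet (B H : DiffBasis) (E : Set Circle) : Prop :=
  ∃ f : ℂ → ℝ, Integrable f ∧
    (∀ γ ∈ E, ∀ᵐ x : ℂ, upperD (rotSets B.sets γ) f x = ⊤) ∧
    (∀ γ ∉ E, Differentiates (rotSets H.sets γ) f)

theorem aux_isometry (γ : Circle) (x : ℂ) :
    Isometry (fun y : ℂ => x + (γ : ℂ) * (y - x)) := by
  refine Isometry.of_dist_eq fun a b => ?_
  rw [Complex.dist_eq, Complex.dist_eq]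
  have : x + (γ : ℂ) * (a - x) - (x + (γ : ℂ) * (b - x)) = (γ : ℂ) * (a - b) := by ring
  rw [this, norm_mul, Circle.norm_coe, one_mul]

theorem aux_neBot (B : DiffBasis) (γ : Circle) (x : ℂ) :
    (basisFilter (rotSets B.sets γ x)).NeBot := by
  obtain ⟨Rk, hR, hd⟩ := B.shrink x
  have : Tendsto (fun k => (fun y : ℂ => x + (γ : ℂ) * (y - x)) '' Rk k) atTop
      (basisFilter (rotSets B.sets γ x)) := by
    refine tendsto_iInf.2 fun r => tendsto_principal.2 ?_
    filter_upwards [hd.eventually (gt_mem_nhds r.2)] with k hk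
    refine ⟨⟨Rk k, hR k, rfl⟩, ?_⟩
    rw [(aux_isometry γ x).diam_image]
    exact hk
  exact this.neBot

theorem aux_avg (B : DiffBasis) (γ : Circle) (x : ℂ) {f g : ℂ → ℝ} (h : f =ᶠ[𝓝 x] g) :
    ∀ᶠ R in basisFilter (rotSets B.sets γ x), ((avgI f R : ℝ) : EReal) = ((avgI g R : ℝ) : EReal) := by
  obtain ⟨r, hr, hfg⟩ := Metric.eventually_nhds_iff_ball.1 h
  refine mem_iInf_of_mem (⟨r, hr⟩ : {r : ℝ // 0 < r}) ?_
  refine mem_principal.2 ?_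
  rintro R ⟨⟨Q, hQ, rfl⟩, hd⟩
  dsimp only at hd ⊢
  have hb := (aux_isometry γ x).lipschitz.isBounded_image (B.bounded x Q hQ)
  have hsub : (fun y : ℂ => x + (γ : ℂ) * (y - x)) '' Q ⊆ Metric.ball x r := by
    intro z hz
    refine lt_of_le_of_lt (Metric.dist_le_diam_of_mem hb hz ?_) hd
    exact ⟨x, B.mem_self x Q hQ, by simp⟩
  have : ∫ z in (fun y : ℂ => x + (γ : ℂ) * (y - x)) '' Q, f z
      = ∫ z in (fun y : ℂ => x + (γ : ℂ) * (y - x)) '' Q, g z := by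
    refine integral_congr_ae ?_
    refine ae_mono (Measure.restrict_mono hsub le_rfl) ?_
    exact (ae_restrict_iff' Metric.isOpen_ball.measurableSet).2 (Eventually.of_forall hfg)
  show ((avgI f _ : ℝ) : EReal) = ((avgI g _ : ℝ) : EReal)
  rw [avgI, avgI, this]

theorem aux_upper (B : DiffBasis) (γ : Circle) (x : ℂ) {f g : ℂ → ℝ} {c : ℝ} (hc : 0 < c)
    (h : f =ᶠ[𝓝 x] fun y => c * g y) :
    upperD (rotSets B.sets γ) f x = (c : EReal) * upperD (rotSets B.sets γ) g x := by
  have := aux_neBot B γ x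
  rw [upperD, upperD, limsup_congr (aux_avg B γ x h),
    ← EReal.limsup_const_mul_of_nonneg_of_ne_top (by exact_mod_cast hc.le) (EReal.coe_ne_top c)]
  congr 1
  ext R
  rw [← EReal.coe_mul, avgI, avgI, integral_const_mul]
  congr 1
  ring

theorem aux_lower (B : DiffBasis) (γ : Circle) (x : ℂ) {f g : ℂ → ℝ} {c : ℝ} (hc : 0 < c)
    (h : f =ᶠ[𝓝 x] fun y => c * g y) :
    lowerD (rotSets B.sets γ) f x = (c : EReal) * lowerD (rotSets B.sets γ) g x := by
  have := aux_neBot B γ x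
  rw [lowerD, lowerD, liminf_congr (aux_avg B γ x h),
    ← EReal.liminf_const_mul_of_nonneg_of_ne_top (by exact_mod_cast hc.le) (EReal.coe_ne_top c)]
  congr 1
  ext R
  rw [← EReal.coe_mul, avgI, avgI, integral_const_mul]
  congr 1
  ring

/-- index of the strip containing a point -/
def stripIdx (x : ℂ) : ℕ := ⌊x.re⌋.natAbs

theorem aux_measurable : Measurable stripIdx :=
  (measurable_from_top (f := Int.natAbs)).comp (Int.measurable_floor.comp Complex.measurable_re)

theorem aux_locconst (n : ℤ) (x : ℂ) (hx : x.re ∈ Ioo (n : ℝ) (n + 1)) :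
    stripIdx x = n.natAbs ∧ ∀ᶠ y in 𝓝 x, stripIdx y = n.natAbs := by
  have key : ∀ y : ℂ, y.re ∈ Ioo (n : ℝ) (n + 1) → stripIdx y = n.natAbs := by
    intro y hy
    rw [stripIdx, Int.floor_eq_iff.2 ⟨hy.1.le, hy.2⟩]
  refine ⟨key x hx, ?_⟩
  filter_upwards [(isOpen_Ioo.preimage Complex.continuous_re).mem_nhds hx] with y hy
  exact key y hy

theorem aux_null : ∀ᵐ x : ℂ, ∃ n : ℤ, x.re ∈ Ioo (n : ℝ) (n + 1) := by
  have h1 : ∀ᵐ x : ℂ, ∀ n : ℤ, x.re ≠ n := by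
    refine ae_all_iff.2 fun n => ?_
    have h2 : ∀ᵐ p : ℝ × ℝ, p.1 ≠ n :=
      Measure.quasiMeasurePreserving_fst.ae (p := fun t : ℝ => t ≠ n) (Measure.ae_ne volume (n : ℝ))
    exact Complex.volume_preserving_equiv_real_prod.quasiMeasurePreserving.ae h2
  filter_upwards [h1] with x hx
  exact ⟨⌊x.re⌋, lt_of_le_of_ne (Int.floor_le _) (hx _).symm, Int.lt_floor_add_one _⟩

/-- a nonempty at most countable union of `R_{B,H}`-sets is a `W_{B,H}`-set. -/
theorem countable_union_of_RSets_is_WSet (B H : DiffBasis)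
    (hBH : ∀ x, B.sets x ⊆ H.sets x) (N : Set ℕ) (hN : N.Nonempty)
    (E : ℕ → Set Circle) (hE : ∀ k ∈ N, IsRSet B H (E k)) :
    ∃ f : ℂ → ℝ, Integrable f ∧
      (∀ γ ∈ ⋃ k ∈ N, E k, ¬ Differentiates (rotSets B.sets γ) f) ∧
      (∀ γ ∉ ⋃ k ∈ N, E k, Differentiates (rotSets H.sets γ) f) := by
  classical
  obtain ⟨k0, hk0⟩ := hN
  have hex : ∀ n : ℕ, ∃ k ∈ N, n ∈ N → k = n := by
    intro n
    by_cases hn : n ∈ N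
    · exact ⟨n, hn, fun _ => rfl⟩
    · exact ⟨k0, hk0, fun h => absurd h hn⟩
  choose e heN he using hex
  choose F hFi hFE hFc using fun n => hE (e n) (heN n)
  let c : ℕ → ℝ := fun n => (1 / 2) ^ n / (1 + ∫ x, ‖F n x‖)
  have hI : ∀ n, 0 ≤ ∫ x, ‖F n x‖ := fun n => integral_nonneg fun _ => norm_nonneg _
  have hc : ∀ n, 0 < c n := fun n => div_pos (by positivity) (by linarith [hI n])
  let f : ℂ → ℝ := fun x => c (stripIdx x) * F (stripIdx x) x
  have hloc : ∀ (n : ℤ) (x : ℂ), x.re ∈ Ioo (n : ℝ) (n + 1) →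
      f =ᶠ[𝓝 x] fun y => c n.natAbs * F n.natAbs y := by
    intro n x hx
    filter_upwards [(aux_locconst n x hx).2] with y hy
    simp only [f, hy]
  refine ⟨f, ?_, ?_, ?_⟩
  · have hms : ∀ n, MeasurableSet (stripIdx ⁻¹' {n}) := fun n =>
      aux_measurable (measurableSet_singleton n)
    have heq : ∀ n, EqOn (fun y => c n * F n y) f (stripIdx ⁻¹' {n}) := by
      intro n y hy
      have hy : stripIdx y = n := hy
      simp only [f, hy]
    have hU : (⋃ n, stripIdx ⁻¹' {n}) = (univ : Set ℂ) := by
      ext x; simp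
    rw [← integrableOn_univ, ← hU]
    refine integrableOn_iUnion_of_summable_integral_norm (fun n => ?_) ?_
    · exact (((hFi n).const_mul (c n)).integrableOn).congr_fun (heq n) (hms n)
    · refine Summable.of_nonneg_of_le (fun n => integral_nonneg fun _ => norm_nonneg _)
        (fun n => ?_) summable_geometric_two
      calc ∫ x in stripIdx ⁻¹' {n}, ‖f x‖
          = ∫ x in stripIdx ⁻¹' {n}, ‖c n * F n x‖ :=
            setIntegral_congr_fun (hms n) fun x hx => by
              simp only [← heq n hx]
        _ ≤ ∫ x, ‖c n * F n x‖ :=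
            setIntegral_le_integral ((hFi n).const_mul (c n)).norm
              (Eventually.of_forall fun _ => norm_nonneg _)
        _ = c n * ∫ x, ‖F n x‖ := by
            simp_rw [norm_mul, Real.norm_of_nonneg (hc n).le]
            rw [integral_const_mul]
        _ ≤ (1 / 2) ^ n := by
            simp only [c]
            rw [div_mul_eq_mul_div, div_le_iff₀ (by linarith [hI n])]
            have : (0 : ℝ) < (1 / 2) ^ n := by positivity
            nlinarith [hI n]
  · intro γ hγ hD
    simp only [mem_iUnion] at hγ
    obtain ⟨k, hk, hγ⟩ := hγ
    have h1 := hFE k γ (by rw [he k hk]; exact hγ)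
    have hae : ∀ᵐ x : ℂ, ¬ x.re ∈ Ioo ((k : ℤ) : ℝ) ((k : ℤ) + 1) := by
      filter_upwards [h1, hD] with x hx1 hx2 hx
      have h3 := aux_upper B γ x (hc _) (hloc k x hx)
      rw [hx2.1] at h3
      simp only [Int.natAbs_natCast] at h3
      rw [hx1, EReal.coe_mul_top_of_pos (hc k)] at h3
      exact EReal.coe_ne_top _ h3
    have hopen : IsOpen {x : ℂ | x.re ∈ Ioo ((k : ℤ) : ℝ) ((k : ℤ) + 1)} :=
      isOpen_Ioo.preimage Complex.continuous_re
    refine (hopen.measure_pos volume ⟨((k : ℝ) + 1 / 2 : ℝ), ?_⟩).ne' ?_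
    · simp only [mem_setOf_eq, Complex.ofReal_re, mem_Ioo, Int.cast_natCast]
      constructor <;> linarith
    · simpa [ae_iff] using hae
  · intro γ hγ
    simp only [mem_iUnion, not_exists] at hγ
    have h1 : ∀ᵐ x : ℂ, ∀ n, upperD (rotSets H.sets γ) (F n) x = ((F n x : ℝ) : EReal) ∧
        lowerD (rotSets H.sets γ) (F n) x = ((F n x : ℝ) : EReal) :=
      ae_all_iff.2 fun n => hFc n γ (hγ (e n) (heN n))
    filter_upwards [h1, aux_null] with x hx1 hx2
    obtain ⟨n, hn⟩ := hx2
    have hl := hloc n x hn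
    rw [aux_upper H γ x (hc _) hl, aux_lower H γ x (hc _) hl, (hx1 _).1, (hx1 _).2, hl.self_of_nhds,
      EReal.coe_mul]
    exact ⟨rfl, rfl⟩

end
end

section
/- Let B be a translation invariant differentiation basis on ℝ², let f ∈ L¹(ℝ²) be finite everywhere with support contained in (0,1)², and let r > 0, ε > 0, β ∈ (0,1). Then the set W_B^r(f,ε,β) = {γ ∈ Γ₂ : the Lebesgue outer measure of {x ∈ ℝ² : l^r_{B(γ)}(f)(x) > ε} exceeds β} is open in Γ₂, where l^r_{H}(f)(x) = sup{ |(1/|R|)∫_R f − f(x)| : R ∈ H(x), diam R < r }. -/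
open MeasureTheory Filter Set Topology

noncomputable section

/-- `l^r_H(f)(x)`: the supremum of `|(1/|R|)∫_R f − f(x)|` over `R ∈ H(x)` with `diam R < r`. -/
def lr (S : ℂ → Set (Set ℂ)) (f : ℂ → ℝ) (r : ℝ) (x : ℂ) : EReal :=
  ⨆ R : {R : Set ℂ // R ∈ S x ∧ Metric.diam R < r}, ((|avgI f R.1 - f x| : ℝ) : EReal)

/-- Rotation by `γ` around `x`. -/
def rotMap (x : ℂ) (γ : Circle) (y : ℂ) : ℂ := x + (γ : ℂ) * (y - x)

theorem rotMap_isometry (x : ℂ) (γ : Circle) : Isometry (rotMap x γ) := by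
  refine Isometry.of_dist_eq fun a b => ?_
  have h : rotMap x γ a - rotMap x γ b = (γ : ℂ) * (a - b) := by
    unfold rotMap; ring
  rw [dist_eq_norm, dist_eq_norm, h, norm_mul, Circle.norm_coe, one_mul]

theorem rotMap_measurePreserving (x : ℂ) (γ : Circle) :
    MeasurePreserving (rotMap x γ) volume volume := by
  have h1 : MeasurePreserving (fun y : ℂ => y - x) volume volume :=
    measurePreserving_sub_right volume x
  have h2 : MeasurePreserving (rotation γ) (volume : Measure ℂ) volume :=
    (rotation γ).measurePreserving
  have h3 : MeasurePreserving (fun y : ℂ => x + y) volume volume :=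
    measurePreserving_add_left volume x
  exact h3.comp (h2.comp h1)

theorem avgI_rot (f : ℂ → ℝ) (R : Set ℂ) (x : ℂ) (γ : Circle) :
    avgI f (rotMap x γ '' R) = (volume R).toReal⁻¹ * ∫ y in R, f (rotMap x γ y) := by
  have hmp := rotMap_measurePreserving x γ
  have hemb : MeasurableEmbedding (rotMap x γ) :=
    (rotMap_isometry x γ).isClosedEmbedding.measurableEmbedding
  have hv : volume (rotMap x γ '' R) = volume R := by
    rw [← hmp.measure_preimage_emb hemb, (rotMap_isometry x γ).injective.preimage_image]
  unfold avgI
  rw [hv, hmp.setIntegral_image_emb hemb]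

theorem continuous_avgI_rot (f : ℂ → ℝ) (hf : Integrable f) (R : Set ℂ) (x : ℂ) :
    Continuous fun γ : Circle => avgI f (rotMap x γ '' R) := by
  simp_rw [avgI_rot]
  refine continuous_const.mul ?_
  have hm : MemLp f 1 volume := memLp_one_iff_integrable.2 hf
  let G : C(Circle, C(ℂ, ℂ)) :=
    ContinuousMap.curry ⟨fun p : Circle × ℂ => rotMap x p.1 p.2, by unfold rotMap; fun_prop⟩
  have hG : ∀ γ, MeasurePreserving (G γ) volume volume := fun γ => rotMap_measurePreserving x γ
  have hc : Continuous fun γ => Lp.compMeasurePreserving (G γ) (hG γ) (hm.toLp f) :=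
    Continuous.compMeasurePreservingLp continuous_const G.continuous hG ENNReal.one_ne_top
  have h2 := (continuous_setIntegral (μ := (volume : Measure ℂ)) (E := ℝ) R).comp hc
  refine h2.congr fun γ => ?_
  refine integral_congr_ae (ae_restrict_of_ae ?_)
  exact MemLp.coeFn_toLp (hm.comp_measurePreserving (hG γ))

/-- for a translation invariant basis `B`, `f ∈ L¹` supported in `(0,1)²`, and
`r > 0`, `ε > 0`, `β ∈ (0,1)`, the set `W_B^r(f,ε,β)` of rotations `γ` for which the outer
measure of `{l^r_{B(γ)}(f) > ε}` exceeds `β` is open in `Γ₂`. -/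
theorem Wr_set_isOpen (B : DiffBasis) (hB : B.TI) (f : ℂ → ℝ) (hf : Integrable f)
    (hsupp : Function.support f ⊆ unitSquare) (r ε β : ℝ) (hr : 0 < r) (hε : 0 < ε)
    (hβ : β ∈ Set.Ioo (0:ℝ) 1) :
    IsOpen {γ : Circle |
      ENNReal.ofReal β < volume {x : ℂ | (ε : EReal) < lr (rotSets B.sets γ) f r x}} := by
  have key : ∀ (γ₀ : Circle) (x : ℂ), (ε : EReal) < lr (rotSets B.sets γ₀) f r x →
      ∀ᶠ γ in 𝓝 γ₀, (ε : EReal) < lr (rotSets B.sets γ) f r x := by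
    intro γ₀ x hx
    obtain ⟨⟨_, ⟨R, hR, rfl⟩, hd⟩, hlt⟩ := lt_iSup_iff.1 hx
    replace hd : Metric.diam (rotMap x γ₀ '' R) < r := hd
    replace hlt : ε < |avgI f (rotMap x γ₀ '' R) - f x| := EReal.coe_lt_coe_iff.1 hlt
    have hcont : Continuous fun γ : Circle => |avgI f (rotMap x γ '' R) - f x| :=
      ((continuous_avgI_rot f hf R x).sub continuous_const).abs
    filter_upwards [hcont.continuousAt.eventually_const_lt hlt] with γ hγ
    refine lt_iSup_iff.2 ⟨⟨rotMap x γ '' R, ⟨R, hR, rfl⟩, ?_⟩, EReal.coe_lt_coe_iff.2 hγ⟩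
    rw [(rotMap_isometry x γ).diam_image]
    rwa [(rotMap_isometry x γ₀).diam_image] at hd
  rw [isOpen_iff_mem_nhds]
  intro γ₀ hγ₀
  let A : ℕ → Set ℂ := fun n => {x | ∀ γ, dist γ γ₀ < 1 / ((n : ℝ) + 1) →
    (ε : EReal) < lr (rotSets B.sets γ) f r x}
  have hA : Monotone A := by
    intro m n hmn x hx γ hγ
    exact hx γ (hγ.trans_le (one_div_le_one_div_of_le (by positivity) (by gcongr)))
  have hU : {x : ℂ | (ε : EReal) < lr (rotSets B.sets γ₀) f r x} ⊆ ⋃ n, A n := by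
    intro x hx
    obtain ⟨δ, hδ, h⟩ := Metric.eventually_nhds_iff.1 (key γ₀ x hx)
    obtain ⟨n, hn⟩ := exists_nat_one_div_lt hδ
    exact mem_iUnion.2 ⟨n, fun γ hγ => h (hγ.trans hn)⟩
  have hlt : ENNReal.ofReal β < ⨆ n, volume (A n) := by
    rw [← hA.measure_iUnion]
    exact lt_of_lt_of_le hγ₀ (measure_mono hU)
  obtain ⟨n, hn⟩ := lt_iSup_iff.1 hlt
  refine Metric.mem_nhds_iff.2 ⟨1 / ((n : ℝ) + 1), by positivity, fun γ hγ => ?_⟩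
  exact lt_of_lt_of_le hn (measure_mono fun x hx => hx γ hγ)

end
end

section
/- Let I be the basis of intervals on ℝ², i.e., for each x ∈ ℝ², I(x) is the family of all open two-dimensional intervals (open axis-parallel rectangles) containing x. Then for every f ∈ L¹(ℝ²) with support contained in (0,1)², the set R_I(f) = {γ ∈ Γ₂ : the upper derivative D̄_{I(γ)}(∫f, x) equals +∞ for almost every x ∈ (0,1)²} is of type G_δ in Γ₂ (a countable intersection of open subsets of the circle Γ₂). -/
open MeasureTheory Filter Set Topology

noncomputable section

/-- The basis of intervals on the plane: all open axis-parallel rectangles containing `x`. -/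
def intervalSets : ℂ → Set (Set ℂ) := fun x =>
  {R | ∃ a b c d : ℝ, a < x.re ∧ x.re < b ∧ c < x.im ∧ x.im < d ∧
    R = {z : ℂ | z.re ∈ Set.Ioo a b ∧ z.im ∈ Set.Ioo c d}}

/-- The rotated and translated copy of `Q`. -/
def rotCopy (γ : Circle) (x : ℂ) (Q : Set ℂ) : Set ℂ := (fun q => x + (γ : ℂ) * q) '' Q

lemma rotCopy_eq_preimage (γ : Circle) (x : ℂ) (Q : Set ℂ) :
    rotCopy γ x Q = (fun z => (γ : ℂ)⁻¹ * (z - x)) ⁻¹' Q := by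
  have h0 : (γ : ℂ) ≠ 0 := Circle.coe_ne_zero γ
  ext z
  simp only [rotCopy, mem_image, mem_preimage]
  constructor
  · rintro ⟨q, hq, rfl⟩
    simpa [h0] using hq
  · intro h
    exact ⟨_, h, by field_simp; ring⟩

lemma rotSets_interval (γ : Circle) (x : ℂ) :
    rotSets intervalSets γ x = (fun Q => rotCopy γ x Q) '' intervalSets 0 := by
  ext R
  simp only [rotSets, mem_image]
  constructor
  · rintro ⟨R, ⟨a, b, c, d, ha, hb, hc, hd, rfl⟩, rfl⟩
    refine ⟨_, ⟨a - x.re, b - x.re, c - x.im, d - x.im, by simpa using ha, by simpa using hb,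
      by simpa using hc, by simpa using hd, rfl⟩, ?_⟩
    ext z
    simp only [rotCopy, mem_image, mem_ofPred_eq, mem_Ioo]
    constructor
    · rintro ⟨q, ⟨⟨h1, h2⟩, h3, h4⟩, rfl⟩
      refine ⟨q + x, ?_, by ring⟩
      simp only [Complex.add_re, Complex.add_im]
      refine ⟨⟨?_, ?_⟩, ?_, ?_⟩ <;> linarith
    · rintro ⟨q, ⟨⟨h1, h2⟩, h3, h4⟩, rfl⟩
      refine ⟨q - x, ?_, by ring⟩
      simp only [Complex.sub_re, Complex.sub_im]
      refine ⟨⟨?_, ?_⟩, ?_, ?_⟩ <;> linarith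
  · rintro ⟨R, ⟨a, b, c, d, ha, hb, hc, hd, rfl⟩, rfl⟩
    simp only [Complex.zero_re, Complex.zero_im] at ha hb hc hd
    refine ⟨_, ⟨a + x.re, b + x.re, c + x.im, d + x.im, by linarith, by linarith,
      by linarith, by linarith, rfl⟩, ?_⟩
    ext z
    simp only [rotCopy, mem_image, mem_ofPred_eq, mem_Ioo]
    constructor
    · rintro ⟨q, ⟨⟨h1, h2⟩, h3, h4⟩, rfl⟩
      refine ⟨q - x, ?_, by ring⟩
      simp only [Complex.sub_re, Complex.sub_im]
      refine ⟨⟨?_, ?_⟩, ?_, ?_⟩ <;> linarith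
    · rintro ⟨q, ⟨⟨h1, h2⟩, h3, h4⟩, rfl⟩
      refine ⟨q + x, ?_, by ring⟩
      simp only [Complex.add_re, Complex.add_im]
      refine ⟨⟨?_, ?_⟩, ?_, ?_⟩ <;> linarith

lemma diam_rotCopy (γ : Circle) (x : ℂ) (Q : Set ℂ) :
    Metric.diam (rotCopy γ x Q) = Metric.diam Q := by
  apply Isometry.diam_image
  apply Isometry.of_dist_eq
  intro p q
  rw [dist_eq_norm, dist_eq_norm, add_sub_add_left_eq_sub, ← mul_sub, norm_mul, Circle.norm_coe, one_mul]

lemma mp_rot (γ : Circle) (x : ℂ) :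
    MeasurePreserving (fun z : ℂ => (γ : ℂ)⁻¹ * (z - x)) volume volume := by
  have h1 := measurePreserving_sub_right (volume : Measure ℂ) x
  have h2 := (rotation γ⁻¹).measurePreserving
  have := h2.comp h1
  have he : (fun z : ℂ => (γ : ℂ)⁻¹ * (z - x)) = ⇑(rotation γ⁻¹) ∘ fun z => z - x := by
    funext z
    rw [Function.comp_apply, rotation_apply, Circle.coe_inv]
  rw [he]
  exact this

lemma interval_props {Q : Set ℂ} (hQ : Q ∈ intervalSets 0) : IsOpen Q ∧ Convex ℝ Q := by
  obtain ⟨a, b, c, d, -, -, -, -, rfl⟩ := hQ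
  exact ⟨(isOpen_Ioo (a := a) (b := b)).reProdIm (isOpen_Ioo (a := c) (b := d)),
    ((convex_Ioo a b).linear_preimage Complex.reLm).inter
      ((convex_Ioo c d).linear_preimage Complex.imLm)⟩

lemma continuous_avg (f : ℂ → ℝ) (hf : Integrable f) {Q : Set ℂ} (ho : IsOpen Q)
    (hc : Convex ℝ Q) :
    Continuous (fun p : Circle × ℂ => avgI f (rotCopy p.1 p.2 Q)) := by
  have hm : ∀ p : Circle × ℂ, MeasurableSet (rotCopy p.1 p.2 Q) := by
    intro p
    rw [rotCopy_eq_preimage]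
    exact (mp_rot p.1 p.2).measurable ho.measurableSet
  have hv : ∀ p : Circle × ℂ, volume (rotCopy p.1 p.2 Q) = volume Q := by
    intro p
    rw [rotCopy_eq_preimage]
    exact (mp_rot p.1 p.2).measure_preimage ho.measurableSet.nullMeasurableSet
  simp only [avgI, hv]
  apply continuous_const.mul
  have : (fun p : Circle × ℂ => ∫ z in rotCopy p.1 p.2 Q, f z)
      = fun p => ∫ z, (rotCopy p.1 p.2 Q).indicator f z := by
    ext p
    rw [integral_indicator (hm p)]
  rw [this, continuous_iff_continuousAt]
  intro p₀
  apply continuousAt_of_dominated (bound := fun z => ‖f z‖)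
  · exact Eventually.of_forall fun p => hf.aestronglyMeasurable.indicator (hm p)
  · exact Eventually.of_forall fun p => Eventually.of_forall fun z => norm_indicator_le_norm_self _ _
  · exact hf.norm
  · have h0 : ∀ᵐ q : ℂ, q ∉ frontier Q := by
      rw [← measure_eq_zero_iff_ae_notMem]
      exact hc.addHaar_frontier volume
    have h1 := (mp_rot p₀.1 p₀.2).quasiMeasurePreserving.ae h0
    filter_upwards [h1] with z hz
    have hcont : Continuous (fun p : Circle × ℂ => ((p.1 : ℂ))⁻¹ * (z - p.2)) := by
      simp_rw [← Circle.coe_inv]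
      fun_prop
    have hcomp : (fun p : Circle × ℂ => (rotCopy p.1 p.2 Q).indicator f z)
        = fun p => Q.indicator (fun _ => f z) (((p.1 : ℂ))⁻¹ * (z - p.2)) := by
      ext p
      rw [rotCopy_eq_preimage]
      rfl
    rw [hcomp]
    have := ContinuousOn.continuousAt_indicator (f := fun _ : ℂ => f z) continuousOn_const hz
    exact ContinuousAt.comp (f := fun p : Circle × ℂ => ((p.1 : ℂ))⁻¹ * (z - p.2)) this
      hcont.continuousAt

/-- The good open sets. -/
def goodU (f : ℂ → ℝ) (n : ℕ) : Set (Circle × ℂ) :=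
  ⋃ Q ∈ {Q | Q ∈ intervalSets 0 ∧ Metric.diam Q < 1 / ((n : ℝ) + 1)},
    {p | (n : ℝ) < avgI f (rotCopy p.1 p.2 Q)}

lemma isOpen_goodU (f : ℂ → ℝ) (hf : Integrable f) (n : ℕ) : IsOpen (goodU f n) := by
  refine isOpen_biUnion fun Q hQ => ?_
  obtain ⟨h1, h2⟩ := interval_props hQ.1
  exact isOpen_lt continuous_const (continuous_avg f hf h1 h2)

lemma upperD_top_iff (f : ℂ → ℝ) (γ : Circle) (x : ℂ) :
    upperD (rotSets intervalSets γ) f x = ⊤ ↔ ∀ n, (γ, x) ∈ goodU f n := by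
  have hb : (basisFilter (rotSets intervalSets γ x)).HasBasis (fun r : ℝ => 0 < r)
      (fun r => {R ∈ rotSets intervalSets γ x | Metric.diam R < r}) := by
    rw [basisFilter, iInf_subtype]
    apply hasBasis_biInf_principal (s := fun r : ℝ => {R ∈ rotSets intervalSets γ x | Metric.diam R < r}) (S := {r : ℝ | 0 < r})
    · intro r hr s hs
      refine ⟨min r s, mem_ofPred_eq ▸ lt_min (by simpa using hr) (by simpa using hs), ?_, ?_⟩
      · exact fun R hR => ⟨hR.1, hR.2.trans_le (min_le_left _ _)⟩
      · exact fun R hR => ⟨hR.1, hR.2.trans_le (min_le_right _ _)⟩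
    · exact ⟨1, by simp⟩
  rw [upperD, hb.limsup_eq_iInf_iSup]
  simp only [iInf_eq_top]
  constructor
  · intro h n
    have h1 := h (1 / ((n : ℝ) + 1)) (by positivity)
    have h2 := lt_of_lt_of_eq (EReal.coe_lt_top (n : ℝ)) h1.symm
    simp only [lt_iSup_iff] at h2
    obtain ⟨R, hR, h3⟩ := h2
    obtain ⟨hR1, hR2⟩ := hR
    rw [rotSets_interval] at hR1
    obtain ⟨Q, hQ, rfl⟩ := hR1
    simp only [diam_rotCopy] at hR2
    simp only [goodU, mem_iUnion]
    exact ⟨Q, ⟨hQ, hR2⟩, by exact_mod_cast h3⟩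
  · intro h r hr
    rw [EReal.eq_top_iff_forall_lt]
    intro y
    obtain ⟨n1, hn1⟩ := exists_nat_gt y
    obtain ⟨n2, hn2⟩ := exists_nat_one_div_lt hr
    have hh := h (max n1 n2)
    simp only [goodU, mem_iUnion] at hh
    obtain ⟨Q, ⟨hQ, hd⟩, h3⟩ := hh
    simp only [mem_ofPred_eq] at h3
    have h4 : (n1 : ℝ) ≤ (max n1 n2 : ℕ) := by exact_mod_cast le_max_left _ _
    have h5 : (n2 : ℝ) ≤ (max n1 n2 : ℕ) := by exact_mod_cast le_max_right _ _
    have h6 : 1 / (((max n1 n2 : ℕ) : ℝ) + 1) ≤ 1 / ((n2 : ℝ) + 1) := by gcongr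
    simp only [lt_iSup_iff]
    refine ⟨rotCopy γ x Q, ⟨?_, ?_⟩, ?_⟩
    · rw [rotSets_interval]
      exact ⟨Q, hQ, rfl⟩
    · rw [diam_rotCopy]
      linarith
    · rw [EReal.coe_lt_coe_iff]
      linarith

lemma isOpen_gt (S : Set ℂ) (hS : IsOpen S) (U : Set (Circle × ℂ)) (hU : IsOpen U) (t : ENNReal) :
    IsOpen {γ : Circle | t < volume (S ∩ {x | (γ, x) ∈ U})} := by
  rw [isOpen_iff_mem_nhds]
  intro γ hγ
  have ho : IsOpen (S ∩ {x | (γ, x) ∈ U}) :=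
    hS.inter (hU.preimage (by fun_prop : Continuous fun x : ℂ => (γ, x)))
  obtain ⟨K, hK, hKc, hKt⟩ := ho.exists_lt_isCompact hγ
  have hsub : ({γ} : Set Circle) ×ˢ K ⊆ U := by
    rintro ⟨g, x⟩ ⟨hg, hx⟩
    rw [mem_singleton_iff] at hg
    simp only at hg
    subst hg
    exact (hK hx).2
  obtain ⟨V, W, hV, -, hγV, hKW, hVW⟩ := generalized_tube_lemma isCompact_singleton hKc hU hsub
  refine mem_of_superset (hV.mem_nhds (hγV rfl)) fun g hg => ?_
  refine lt_of_lt_of_le hKt (measure_mono fun x hx => ⟨(hK hx).1, hVW ⟨hg, hKW hx⟩⟩)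

lemma unitSquare_eq : unitSquare = Ioo (0:ℝ) 1 ×ℂ Ioo (0:ℝ) 1 := rfl

lemma isOpen_unitSquare : IsOpen unitSquare := isOpen_Ioo.reProdIm isOpen_Ioo

lemma volume_unitSquare_ne_top : volume unitSquare ≠ ⊤ := by
  have : Bornology.IsBounded unitSquare :=
    (Metric.isBounded_Ioo (0:ℝ) 1).reProdIm (Metric.isBounded_Ioo (0:ℝ) 1)
  exact this.measure_lt_top.ne

lemma isGδ_ae (S : Set ℂ) (hS : IsOpen S) (hfin : volume S ≠ ⊤) (U : Set (Circle × ℂ))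
    (hU : IsOpen U) : IsGδ {γ : Circle | ∀ᵐ x : ℂ, x ∈ S → (γ, x) ∈ U} := by
  by_cases hz : volume S = 0
  · have : {γ : Circle | ∀ᵐ x : ℂ, x ∈ S → (γ, x) ∈ U} = univ := by
      ext γ
      simp only [mem_ofPred_eq, mem_univ, iff_true]
      filter_upwards [measure_eq_zero_iff_ae_notMem.1 hz] with x hx h
      exact absurd h hx
    rw [this]
    exact IsGδ.univ
  have : {γ : Circle | ∀ᵐ x : ℂ, x ∈ S → (γ, x) ∈ U}
      = ⋂ n : ℕ, {γ : Circle | volume S - ((n : ENNReal) + 1)⁻¹ < volume (S ∩ {x | (γ, x) ∈ U})} := by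
    ext γ
    simp only [mem_ofPred_eq, mem_iInter]
    constructor
    · intro h n
      have : volume (S ∩ {x | (γ, x) ∈ U}) = volume S := by
        apply measure_congr
        filter_upwards [h] with x hx
        apply propext
        exact ⟨fun h => h.1, fun h => ⟨h, hx h⟩⟩
      rw [this]
      exact ENNReal.sub_lt_self hfin hz (by simp)
    · intro h
      have ho : IsOpen (S ∩ {x | (γ, x) ∈ U}) :=
        hS.inter (hU.preimage (by fun_prop : Continuous fun x : ℂ => (γ, x)))
      have hle : volume S ≤ volume (S ∩ {x | (γ, x) ∈ U}) := by
        apply ENNReal.le_of_forall_pos_le_add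
        intro ε hε _
        obtain ⟨n, hn⟩ := ENNReal.exists_inv_nat_lt (a := (ε : ENNReal)) (by simpa using hε.ne')
        have h1 := tsub_le_iff_right.1 (h n).le
        refine h1.trans ?_
        gcongr
        refine le_trans ?_ hn.le
        gcongr
        exact le_self_add
      have h2 := ae_eq_of_subset_of_measure_ge (inter_subset_left) hle
        ho.measurableSet.nullMeasurableSet hfin
      filter_upwards [h2] with x hx hxS
      have : (S ∩ {x | (γ, x) ∈ U}) x := by rw [hx]; exact hxS
      exact this.2
  rw [this]
  exact IsGδ.iInter_of_isOpen fun n => isOpen_gt S hS U hU _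

/-- for the interval basis `I` on the plane and `f ∈ L¹` supported in `(0,1)²`,
the set of rotations `γ` for which the upper derivative of `∫ f` with respect to `I(γ)` is `+∞`
a.e. on `(0,1)²` is of type `G_δ` in `Γ₂`. -/
theorem Rset_of_interval_basis_isGdelta (f : ℂ → ℝ) (hf : Integrable f)
    (hsupp : Function.support f ⊆ unitSquare) :
    IsGδ {γ : Circle | ∀ᵐ x : ℂ, x ∈ unitSquare → upperD (rotSets intervalSets γ) f x = ⊤} := by
  have : {γ : Circle | ∀ᵐ x : ℂ, x ∈ unitSquare → upperD (rotSets intervalSets γ) f x = ⊤}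
      = ⋂ n : ℕ, {γ : Circle | ∀ᵐ x : ℂ, x ∈ unitSquare → (γ, x) ∈ goodU f n} := by
    ext γ
    simp only [upperD_top_iff, mem_ofPred_eq, mem_iInter]
    rw [← ae_all_iff]
    refine eventually_congr (Eventually.of_forall fun x => ?_)
    exact forall_comm
  rw [this]
  exact IsGδ.iInter fun n => isGδ_ae _ isOpen_unitSquare volume_unitSquare_ne_top _
    (isOpen_goodU f hf n)

end
end

section
/- Let I be the basis of intervals on ℝ², i.e., for each x ∈ ℝ², I(x) is the family of all open two-dimensional intervals (open axis-parallel rectangles) containing x. Then for every f ∈ L¹(ℝ²), the set W_I(f) = {γ ∈ Γ₂ : the integral of f is not differentiable with respect to the rotated basis I(γ)} is of type G_δσ in Γ₂ (a countable union of countable intersections of open subsets of the circle Γ₂). -/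
open MeasureTheory Filter Set Topology

noncomputable section

namespace WS

/-- open box -/
def box (a b c d : ℝ) : Set ℂ := {z : ℂ | z.re ∈ Set.Ioo a b ∧ z.im ∈ Set.Ioo c d}

/-- rotated set -/
def rt (γ : Circle) (Q : Set ℂ) : Set ℂ := {z : ℂ | rotation γ⁻¹ z ∈ Q}

lemma isOpen_box (a b c d : ℝ) : IsOpen (box a b c d) :=
  (isOpen_Ioo.preimage Complex.continuous_re).inter (isOpen_Ioo.preimage Complex.continuous_im)

lemma convex_box (a b c d : ℝ) : Convex ℝ (box a b c d) :=
  ((convex_Ioo a b).linear_preimage Complex.reLm).inter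
    ((convex_Ioo c d).linear_preimage Complex.imLm)

lemma isOpen_rt (γ : Circle) {Q : Set ℂ} (hQ : IsOpen Q) : IsOpen (rt γ Q) :=
  hQ.preimage (rotation γ⁻¹).continuous

lemma volume_rt (γ : Circle) (Q : Set ℂ) : volume (rt γ Q) = volume Q :=
  (rotation γ⁻¹).measurePreserving.measure_preimage_equiv
    (f := (rotation γ⁻¹).toHomeomorph.toMeasurableEquiv) Q

lemma diam_rt (γ : Circle) (Q : Set ℂ) : Metric.diam (rt γ Q) = Metric.diam Q := by
  have h : rotation γ⁻¹ '' (rt γ Q) = Q :=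
    Set.image_preimage_eq Q (rotation γ⁻¹).surjective
  rw [← (rotation γ⁻¹).isometry.diam_image (rt γ Q), h]

lemma continuous_rot (z : ℂ) : Continuous (fun γ : Circle => rotation γ⁻¹ z) := by
  simp only [rotation_apply]
  fun_prop

lemma mem_rotSets (γ : Circle) (x : ℂ) (R : Set ℂ) :
    R ∈ rotSets intervalSets γ x ↔ ∃ a b c d : ℝ, x ∈ R ∧ R = rt γ (box a b c d) := by
  have hγ : (γ : ℂ) ≠ 0 := Circle.coe_ne_zero γ
  have key : ∀ a b c d : ℝ, (fun y => x + (γ : ℂ) * (y - x)) '' (box a b c d) =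
      rt γ (box (a + ((γ:ℂ)⁻¹ * x - x).re) (b + ((γ:ℂ)⁻¹ * x - x).re)
        (c + ((γ:ℂ)⁻¹ * x - x).im) (d + ((γ:ℂ)⁻¹ * x - x).im)) := by
    intro a b c d
    set t := (γ:ℂ)⁻¹ * x - x with ht
    ext z
    have e : ∀ y, x + (γ : ℂ) * (y - x) = z ↔ y = (γ:ℂ)⁻¹ * z - t := by
      intro y
      rw [ht]
      constructor
      · rintro rfl
        field_simp
        ring
      · rintro rfl
        field_simp
        ring
    simp only [Set.mem_image, e, exists_eq_right]
    simp only [rt, box, Set.mem_ofPred_eq, rotation_apply, Circle.coe_inv, Complex.sub_re,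
      Complex.sub_im, Set.mem_Ioo, lt_sub_iff_add_lt, sub_lt_iff_lt_add]
  constructor
  · rintro ⟨Q, ⟨a, b, c, d, h1, h2, h3, h4, rfl⟩, rfl⟩
    refine ⟨_, _, _, _, ⟨x, ⟨⟨h1, h2⟩, h3, h4⟩, by simp⟩, key a b c d⟩
  · rintro ⟨a, b, c, d, hx, rfl⟩
    set t := (γ:ℂ)⁻¹ * x - x with ht
    have hx' : (((γ:ℂ)⁻¹ * x).re ∈ Set.Ioo a b) ∧ (((γ:ℂ)⁻¹ * x).im ∈ Set.Ioo c d) := by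
      have h0 : rotation γ⁻¹ x ∈ box a b c d := hx
      rw [rotation_apply, Circle.coe_inv] at h0
      exact h0
    have hx2 : (γ:ℂ)⁻¹ * x = x + t := by rw [ht]; ring
    rw [hx2] at hx'
    simp only [Complex.add_re, Complex.add_im, Set.mem_Ioo] at hx'
    refine ⟨box (a - t.re) (b - t.re) (c - t.im) (d - t.im),
      ⟨a - t.re, b - t.re, c - t.im, d - t.im, by linarith, by linarith, by linarith,
        by linarith, rfl⟩, ?_⟩
    have := key (a - t.re) (b - t.re) (c - t.im) (d - t.im)
    simpa using this

lemma exists_small (γ : Circle) (x : ℂ) (r : ℝ) (hr : 0 < r) :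
    ∃ R ∈ rotSets intervalSets γ x, Metric.diam R < r := by
  set w := rotation γ⁻¹ x with hw
  set s := r / 8 with hs
  have hs0 : 0 < s := by positivity
  refine ⟨rt γ (box (w.re - s) (w.re + s) (w.im - s) (w.im + s)), ?_, ?_⟩
  · rw [mem_rotSets]
    refine ⟨_, _, _, _, ?_, rfl⟩
    show rotation γ⁻¹ x ∈ box _ _ _ _
    rw [← hw]
    refine ⟨⟨?_, ?_⟩, ?_, ?_⟩ <;> linarith
  · rw [diam_rt]
    refine lt_of_le_of_lt (Metric.diam_le_of_forall_dist_le (C := 4 * s) (by positivity) ?_)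
      (by rw [hs]; linarith)
    rintro z ⟨⟨h1, h2⟩, h3, h4⟩ y ⟨⟨h5, h6⟩, h7, h8⟩
    rw [Complex.dist_eq]
    refine (Complex.norm_le_abs_re_add_abs_im _).trans ?_
    have : |(z - y).re| ≤ 2 * s := by
      rw [Complex.sub_re, abs_le]; constructor <;> linarith
    have : |(z - y).im| ≤ 2 * s := by
      rw [Complex.sub_im, abs_le]; constructor <;> linarith
    linarith

lemma basis_hasBasis (F : Set (Set ℂ)) : (basisFilter F).HasBasis
    (fun _ : {r : ℝ // 0 < r} => True) (fun r => {R ∈ F | Metric.diam R < r.1}) := by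
  have : Nonempty {r : ℝ // 0 < r} := ⟨⟨1, one_pos⟩⟩
  refine hasBasis_iInf_principal ?_
  intro r s
  refine ⟨⟨min r.1 s.1, lt_min r.2 s.2⟩, ?_, ?_⟩
  · rintro R ⟨h1, h2⟩
    exact ⟨h1, h2.trans_le (min_le_left _ _)⟩
  · rintro R ⟨h1, h2⟩
    exact ⟨h1, h2.trans_le (min_le_right _ _)⟩

lemma diff_congr {S : ℂ → Set (Set ℂ)} {f g : ℂ → ℝ} (h : f =ᵐ[volume] g) :
    Differentiates S f ↔ Differentiates S g := by
  have ha : avgI f = avgI g := by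
    funext R
    unfold avgI
    rw [integral_congr_ae (ae_restrict_of_ae h)]
  unfold Differentiates upperD lowerD
  rw [ha]
  apply eventually_congr
  filter_upwards [h] with x hx
  rw [hx]

/-- the set of bad points at scale `1/(j+1)` -/
def A (g : ℂ → ℝ) (k j : ℕ) (γ : Circle) : Set ℂ :=
  {x | ∃ a b c d : ℝ, x ∈ rt γ (box a b c d) ∧ Metric.diam (box a b c d) < 1 / ((j:ℝ) + 1) ∧
    1 / ((k:ℝ) + 1) < |avgI g (rt γ (box a b c d)) - g x|}

lemma measurable_A (g : ℂ → ℝ) (hg : Measurable g) (k j : ℕ) (γ : Circle) :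
    MeasurableSet (A g k j γ) := by
  have hU : IsOpen {p : ℂ × ℝ | ∃ a b c d : ℝ, p.1 ∈ rt γ (box a b c d) ∧
      Metric.diam (box a b c d) < 1 / ((j:ℝ) + 1) ∧
      1 / ((k:ℝ) + 1) < |avgI g (rt γ (box a b c d)) - p.2|} := by
    simp only [Set.ofPred_exists]
    refine isOpen_iUnion fun a => isOpen_iUnion fun b => isOpen_iUnion fun c =>
      isOpen_iUnion fun d => ?_
    have h3 : IsOpen {p : ℂ × ℝ | 1 / ((k:ℝ) + 1) < |avgI g (rt γ (box a b c d)) - p.2|} :=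
      isOpen_lt continuous_const (by fun_prop)
    exact IsOpen.and ((isOpen_rt γ (isOpen_box a b c d)).preimage continuous_fst)
      (IsOpen.and isOpen_const h3)
  exact (measurable_id.prodMk hg) hU.measurableSet

lemma continuous_avg (g : ℂ → ℝ) (hg : Integrable g) (a b c d : ℝ) :
    Continuous fun γ : Circle => avgI g (rt γ (box a b c d)) := by
  unfold avgI
  simp only [volume_rt]
  refine continuous_const.mul ?_
  set Q := box a b c d with hQ
  have hQo : IsOpen Q := isOpen_box a b c d
  have e : ∀ γ : Circle, ∫ z in rt γ Q, g z = ∫ z, (rt γ Q).indicator g z := fun γ =>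
    (integral_indicator (isOpen_rt γ hQo).measurableSet).symm
  simp only [e]
  rw [continuous_iff_continuousAt]
  intro γ
  refine continuousAt_of_dominated (bound := fun z => ‖g z‖) ?_ ?_ hg.norm ?_
  · exact Eventually.of_forall fun γ' =>
      hg.aestronglyMeasurable.indicator (isOpen_rt γ' hQo).measurableSet
  · exact Eventually.of_forall fun γ' => Eventually.of_forall fun z =>
      norm_indicator_le_norm_self _ _
  · have hnull : volume (rt γ (frontier Q)) = 0 := by
      rw [volume_rt]
      exact (convex_box a b c d).addHaar_frontier volume
    filter_upwards [measure_eq_zero_iff_ae_notMem.1 hnull] with z hz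
    have hc := (continuous_rot z).continuousAt (x := γ)
    by_cases h : rotation γ⁻¹ z ∈ Q
    · have h1 : ∀ᶠ γ' in 𝓝 γ, rotation γ'⁻¹ z ∈ Q := hc (hQo.mem_nhds h)
      have h2 : (fun γ' : Circle => (rt γ' Q).indicator g z) =ᶠ[𝓝 γ] fun _ => g z := by
        filter_upwards [h1] with γ' h'
        exact Set.indicator_of_mem (show z ∈ rt γ' Q from h') g
      exact continuousAt_const.congr h2.symm
    · have h0 : rotation γ⁻¹ z ∉ closure Q := by
        intro hcl
        exact hz ⟨hcl, fun hi => h (interior_subset hi)⟩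
      have h1 : ∀ᶠ γ' in 𝓝 γ, rotation γ'⁻¹ z ∈ (closure Q)ᶜ :=
        hc (isClosed_closure.isOpen_compl.mem_nhds h0)
      have h2 : (fun γ' : Circle => (rt γ' Q).indicator g z) =ᶠ[𝓝 γ] fun _ => 0 := by
        filter_upwards [h1] with γ' h'
        exact Set.indicator_of_notMem (show z ∉ rt γ' Q from fun hh => h' (subset_closure hh)) g
      exact continuousAt_const.congr h2.symm

lemma isOpen_section (g : ℂ → ℝ) (hg : Integrable g) (k j : ℕ) (x : ℂ) :
    IsOpen {γ : Circle | x ∈ A g k j γ} := by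
  change IsOpen {γ : Circle | ∃ a b c d : ℝ, x ∈ rt γ (box a b c d) ∧
    Metric.diam (box a b c d) < 1 / ((j:ℝ) + 1) ∧
    1 / ((k:ℝ) + 1) < |avgI g (rt γ (box a b c d)) - g x|}
  simp only [Set.ofPred_exists]
  refine isOpen_iUnion fun a => isOpen_iUnion fun b => isOpen_iUnion fun c =>
    isOpen_iUnion fun d => ?_
  have h3 : IsOpen {γ : Circle | 1 / ((k:ℝ) + 1) < |avgI g (rt γ (box a b c d)) - g x|} :=
    isOpen_lt continuous_const ((continuous_avg g hg a b c d).sub continuous_const).abs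
  exact IsOpen.and ((isOpen_box a b c d).preimage (continuous_rot x))
    (IsOpen.and isOpen_const h3)

/-- the G-delta pieces -/
def Sset (g : ℂ → ℝ) (k N m : ℕ) : Set Circle :=
  {γ | ∀ j : ℕ, ((m : ENNReal) + 1)⁻¹ < volume (Metric.ball (0:ℂ) N ∩ A g k j γ)}

lemma isOpen_meas {A : Circle → Set ℂ} (hA : ∀ x, IsOpen {γ | x ∈ A γ}) (B : Set ℂ)
    (δ : ENNReal) : IsOpen {γ : Circle | δ < volume (B ∩ A γ)} := by
  rw [isOpen_iff_mem_nhds]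
  intro γ hγ
  let C : ℕ → Set ℂ := fun n => {x | x ∈ B ∧ ∀ γ' ∈ Metric.ball γ (1 / ((n:ℝ) + 1)), x ∈ A γ'}
  have hmono : Monotone C := by
    rintro n n' hn x ⟨h1, h2⟩
    refine ⟨h1, fun γ' h' => h2 γ' (Metric.ball_subset_ball ?_ h')⟩
    exact Nat.one_div_le_one_div hn
  have hsub : B ∩ A γ ⊆ ⋃ n, C n := by
    rintro x ⟨h1, h2⟩
    obtain ⟨ε, hε, hb⟩ := Metric.isOpen_iff.1 (hA x) γ h2
    obtain ⟨n, hn⟩ := exists_nat_one_div_lt hε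
    exact Set.mem_iUnion.2 ⟨n, h1, fun γ' h' => hb (Metric.ball_subset_ball hn.le h')⟩
  have hlt : δ < volume (⋃ n, C n) := lt_of_lt_of_le hγ (measure_mono hsub)
  obtain ⟨n, hn⟩ := ((tendsto_measure_iUnion_atTop hmono).eventually (lt_mem_nhds hlt)).exists
  refine mem_of_superset (Metric.ball_mem_nhds γ (by positivity : 0 < 1 / ((n:ℝ) + 1))) ?_
  intro γ' h'
  refine lt_of_lt_of_le hn (measure_mono ?_)
  rintro x ⟨h1, h2⟩
  exact ⟨h1, h2 γ' h'⟩

lemma Sset_isGdelta (g : ℂ → ℝ) (hg : Integrable g) (k N m : ℕ) : IsGδ (Sset g k N m) := by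
  unfold Sset
  rw [Set.ofPred_forall]
  exact IsGδ.iInter fun j => (isOpen_meas (isOpen_section g hg k j) _ _).isGδ

lemma pointwise (g : ℂ → ℝ) (γ : Circle) (x : ℂ) :
    (upperD (rotSets intervalSets γ) g x = ((g x : ℝ) : EReal) ∧
      lowerD (rotSets intervalSets γ) g x = ((g x : ℝ) : EReal)) ↔
    x ∉ ⋃ k, ⋂ j, A g k j γ := by
  have hB := basis_hasBasis (rotSets intervalSets γ x)
  have : (basisFilter (rotSets intervalSets γ x)).NeBot := by
    rw [hB.neBot_iff]
    rintro r -
    obtain ⟨R, h1, h2⟩ := exists_small γ x r.1 r.2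
    exact ⟨R, h1, h2⟩
  have h1 : (upperD (rotSets intervalSets γ) g x = ((g x : ℝ) : EReal) ∧
      lowerD (rotSets intervalSets γ) g x = ((g x : ℝ) : EReal)) ↔
      Tendsto (avgI g) (basisFilter (rotSets intervalSets γ x)) (𝓝 (g x)) := by
    rw [← EReal.tendsto_coe]
    constructor
    · rintro ⟨hu, hl⟩
      exact tendsto_of_liminf_eq_limsup hl hu
    · intro h
      exact ⟨h.limsup_eq, h.liminf_eq⟩
  rw [h1, hB.tendsto_iff Metric.nhds_basis_ball]
  simp only [Set.mem_iUnion, Set.mem_iInter, not_exists, not_forall]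
  constructor
  · intro h k
    obtain ⟨r, -, hr⟩ := h (1 / ((k:ℝ) + 1)) (by positivity)
    obtain ⟨j, hj⟩ := exists_nat_one_div_lt r.2
    refine ⟨j, ?_⟩
    rintro ⟨a, b, c, d, hx, hd, hlt⟩
    have := hr (rt γ (box a b c d)) ⟨(mem_rotSets _ _ _).2 ⟨a, b, c, d, hx, rfl⟩, by
      rw [diam_rt]; exact hd.trans hj⟩
    rw [Metric.mem_ball, Real.dist_eq] at this
    linarith
  · intro h ε hε
    obtain ⟨k, hk⟩ := exists_nat_one_div_lt hε
    obtain ⟨j, hj⟩ := h k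
    refine ⟨⟨1 / ((j:ℝ) + 1), by positivity⟩, trivial, ?_⟩
    rintro R ⟨hR, hd⟩
    obtain ⟨a, b, c, d, hx, rfl⟩ := (mem_rotSets _ _ _).1 hR
    rw [Metric.mem_ball, Real.dist_eq]
    by_contra hcon
    rw [diam_rt] at hd
    exact hj ⟨a, b, c, d, hx, hd, by linarith⟩

lemma A_anti (g : ℂ → ℝ) (k : ℕ) (γ : Circle) : Antitone fun j => A g k j γ := by
  rintro j j' hj x ⟨a, b, c, d, hx, hd, h⟩
  exact ⟨a, b, c, d, hx, hd.trans_le (Nat.one_div_le_one_div hj), h⟩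

lemma not_diff_iff (g : ℂ → ℝ) (hg : Measurable g) (γ : Circle) :
    ¬ Differentiates (rotSets intervalSets γ) g ↔ ∃ k N m, γ ∈ Sset g k N m := by
  unfold Differentiates
  simp only [pointwise]
  rw [← measure_eq_zero_iff_ae_notMem, measure_iUnion_null_iff, not_forall]
  refine exists_congr fun k => ?_
  have hU : (⋂ j, A g k j γ) = ⋃ N : ℕ, (Metric.ball (0:ℂ) N ∩ ⋂ j, A g k j γ) := by
    rw [← Set.iUnion_inter, Metric.iUnion_ball_nat, Set.univ_inter]
  rw [hU, measure_iUnion_null_iff, not_forall]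
  refine exists_congr fun N => ?_
  have hfin : volume (Metric.ball (0:ℂ) N) ≠ ⊤ := measure_ball_lt_top.ne
  constructor
  · intro h
    obtain ⟨m, hm⟩ := ENNReal.exists_inv_nat_lt h
    refine ⟨m, fun j => ?_⟩
    refine lt_of_le_of_lt (ENNReal.inv_le_inv.2 le_self_add) (hm.trans_le (measure_mono ?_))
    exact Set.inter_subset_inter_right _ (Set.iInter_subset _ j)
  · rintro ⟨m, hm⟩ h0
    rw [Set.inter_iInter] at h0
    have ht := tendsto_measure_iInter_atTop (μ := (volume : Measure ℂ))
      (s := fun j => Metric.ball (0:ℂ) N ∩ A g k j γ)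
      (fun j => (Metric.isOpen_ball.measurableSet.inter
        (measurable_A g hg k j γ)).nullMeasurableSet)
      (fun j j' h => Set.inter_subset_inter_right _ (A_anti g k γ h))
      ⟨0, measure_ne_top_of_subset Set.inter_subset_left hfin⟩
    rw [h0] at ht
    have := ge_of_tendsto' ht (fun j => (hm j).le)
    simp at this

end WS

/-- for the interval basis `I` on the plane and any `f ∈ L¹`, the set of rotations
`γ` for which `∫ f` is not differentiable with respect to `I(γ)` is of type `G_δσ` in `Γ₂`. -/
theorem Wset_of_interval_basis_isGdeltasigma (f : ℂ → ℝ) (hf : Integrable f) :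
    ∃ S : ℕ → Set Circle, (∀ n, IsGδ (S n)) ∧
      {γ : Circle | ¬ Differentiates (rotSets intervalSets γ) f} = ⋃ n, S n := by
  set g : ℂ → ℝ := hf.1.mk f with hgdef
  have hgm : Measurable g := hf.1.stronglyMeasurable_mk.measurable
  have hfg : f =ᵐ[volume] g := hf.1.ae_eq_mk
  have hg : Integrable g := hf.congr hfg
  refine ⟨fun n => WS.Sset g (Nat.unpair n).1 (Nat.unpair (Nat.unpair n).2).1
    (Nat.unpair (Nat.unpair n).2).2, fun n => WS.Sset_isGdelta g hg _ _ _, ?_⟩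
  ext γ
  rw [Set.mem_ofPred_eq, WS.diff_congr hfg, WS.not_diff_iff g hgm γ, Set.mem_iUnion]
  constructor
  · rintro ⟨k, N, m, h⟩
    exact ⟨Nat.pair k (Nat.pair N m), by simpa using h⟩
  · rintro ⟨n, h⟩
    exact ⟨_, _, _, h⟩

end
end

section
/- Let N ⊆ ℕ be nonempty, let (f_k)_{k∈N} be functions in L¹(ℝ²) with ‖f_k‖_{L¹} ≠ 0, and let (Q_k)_{k∈N} be pairwise disjoint open squares in ℝ². Define g_k = f_k·χ_{Q_k} / (2^k ‖f_k‖_{L¹}) and f = Σ_{k∈N} g_k. Then f ∈ L¹(ℝ²) with ‖f‖_{L¹} = Σ_{k∈N} ‖g_k‖_{L¹} ≤ Σ_{k∈N} 2^{−k} < ∞, and for every differentiation basis B on ℝ², every rotation γ ∈ Γ₂, every k ∈ N and every x ∈ Q_k, the upper derivative D̄_{B(γ)}(∫f, x) equals D̄_{B(γ)}(∫g_k, x). -/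
open MeasureTheory Filter Set Topology

noncomputable section

/-- An open square (axis-parallel, with positive side length). -/
def IsOpenSquare (Q : Set ℂ) : Prop :=
  ∃ (a b s : ℝ), 0 < s ∧
    Q = {z : ℂ | z.re ∈ Set.Ioo a (a + s) ∧ z.im ∈ Set.Ioo b (b + s)}

/-- the gluing construction. Given summable pieces `g_k = f_k·χ_{Q_k}/(2^k‖f_k‖₁)`
supported in pairwise disjoint open squares `Q_k`, their sum `F` is integrable with
`‖F‖₁ = Σ‖g_k‖₁ ≤ Σ 2^{-k} < ∞`, and on each `Q_k` the upper derivative of `∫ F` with respect to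
any rotated basis coincides with that of `∫ g_k`. -/
theorem glued_function_properties (N : Set ℕ) (hN : N.Nonempty) (f : ℕ → ℂ → ℝ)
    (hfi : ∀ k ∈ N, Integrable (f k)) (hfne : ∀ k ∈ N, (∫ z, |f k z|) ≠ 0)
    (Q : ℕ → Set ℂ) (hQ : ∀ k ∈ N, IsOpenSquare (Q k))
    (hdisj : ∀ j ∈ N, ∀ k ∈ N, j ≠ k → Disjoint (Q j) (Q k))
    (g : ℕ → ℂ → ℝ)
    (hg : ∀ k ∈ N, ∀ z, g k z = (Q k).indicator (f k) z / ((2 : ℝ) ^ k * ∫ w, |f k w|))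
    (F : ℂ → ℝ) (hF : ∀ z, F z = ∑' k : N, g (k : ℕ) z) :
    Integrable F ∧
    Summable (fun k : N => ∫ z, |g (k : ℕ) z|) ∧
    (∫ z, |F z|) = ∑' k : N, ∫ z, |g (k : ℕ) z| ∧
    (∑' k : N, ∫ z, |g (k : ℕ) z|) ≤ ∑' k : N, ((2 : ℝ) ^ (k : ℕ))⁻¹ ∧
    (∀ (B : DiffBasis) (γ : Circle) (k : ℕ), k ∈ N → ∀ x ∈ Q k,
      upperD (rotSets B.sets γ) F x = upperD (rotSets B.sets γ) (g k) x) := by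
  have hQo : ∀ k ∈ N, IsOpen (Q k) := by
    intro k hk
    obtain ⟨a, b, s, -, h⟩ := hQ k hk
    rw [h]
    exact (isOpen_Ioo.preimage Complex.continuous_re).inter
      (isOpen_Ioo.preimage Complex.continuous_im)
  have hg0 : ∀ k ∈ N, ∀ z, z ∉ Q k → g k z = 0 := by
    intro k hk z hz
    rw [hg k hk, Set.indicator_of_notMem hz, zero_div]
  have hzero : ∀ k ∈ N, ∀ z ∈ Q k, ∀ j : N, (j : ℕ) ≠ k → g j z = 0 := by
    intro k hk z hz j hj
    exact hg0 j j.2 z fun h => Set.disjoint_left.1 (hdisj j j.2 k hk hj) h hz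
  have hFQ : ∀ k ∈ N, ∀ z ∈ Q k, F z = g k z := by
    intro k hk z hz
    rw [hF, tsum_eq_single (⟨k, hk⟩ : N)]
    intro j hj
    exact hzero k hk z hz j fun h => hj (Subtype.ext h)
  have hF0 : ∀ z, (∀ k ∈ N, z ∉ Q k) → F z = 0 := by
    intro z hz
    rw [hF]
    have : ∀ k : N, g k z = 0 := fun k => hg0 k k.2 z (hz k k.2)
    simp [this]
  have hFabs : ∀ z, |F z| = ∑' k : N, |g (k : ℕ) z| := by
    intro z
    by_cases hz : ∃ k ∈ N, z ∈ Q k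
    · obtain ⟨k, hk, hz⟩ := hz
      rw [hFQ k hk z hz, tsum_eq_single (⟨k, hk⟩ : N)]
      intro j hj
      rw [hzero k hk z hz j fun h => hj (Subtype.ext h), abs_zero]
    · push Not at hz
      rw [hF0 z hz]
      have : ∀ k : N, g k z = 0 := fun k => hg0 k k.2 z (hz k k.2)
      simp [this]
  have hgfun : ∀ k ∈ N, g k = fun z => (Q k).indicator (f k) z / ((2 : ℝ) ^ k * ∫ w, |f k w|) :=
    fun k hk => funext (hg k hk)
  have hgi : ∀ k ∈ N, Integrable (g k) := by
    intro k hk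
    rw [hgfun k hk]
    exact ((hfi k hk).indicator (hQo k hk).measurableSet).div_const _
  have hgle : ∀ k ∈ N, (∫ z, |g k z|) ≤ ((2 : ℝ) ^ k)⁻¹ := by
    intro k hk
    have hI : 0 < ∫ w, |f k w| :=
      lt_of_le_of_ne (integral_nonneg fun _ => abs_nonneg _) (hfne k hk).symm
    have h1 : (∫ z, |g k z|) ≤ ∫ z, |f k z| / ((2 : ℝ) ^ k * ∫ w, |f k w|) := by
      refine integral_mono (hgi k hk).abs ((hfi k hk).abs.div_const _) fun z => ?_
      have hc : 0 < (2 : ℝ) ^ k * ∫ w, |f k w| := by positivity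
      simp only [hg k hk z, abs_div, abs_of_pos hc]
      refine div_le_div_of_nonneg_right ?_ hc.le
      by_cases hz : z ∈ Q k
      · rw [Set.indicator_of_mem hz]
      · rw [Set.indicator_of_notMem hz, abs_zero]; exact abs_nonneg _
    refine h1.trans (le_of_eq ?_)
    rw [integral_div]
    field_simp
  have hs2 : Summable (fun k : N => ((2 : ℝ) ^ (k : ℕ))⁻¹) := by
    have : Summable (fun k : ℕ => ((2 : ℝ) ^ k)⁻¹) := by
      simpa [inv_pow] using summable_geometric_two
    exact this.subtype N
  have hs1 : Summable (fun k : N => ∫ z, |g (k : ℕ) z|) :=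
    Summable.of_nonneg_of_le (fun _ => integral_nonneg fun _ => abs_nonneg _)
      (fun k => hgle k k.2) hs2
  have hFi : Integrable F := by
    have hon : IntegrableOn F (⋃ k : N, Q k) := by
      refine integrableOn_iUnion_of_summable_integral_norm (fun k => ?_) ?_
      · exact (hgi k k.2).integrableOn.congr_fun (fun z hz => (hFQ k k.2 z hz).symm)
          (hQo k k.2).measurableSet
      · refine Summable.of_nonneg_of_le (fun _ => integral_nonneg fun _ => norm_nonneg _)
          (fun k => ?_) hs1
        rw [setIntegral_congr_fun (g := fun z => |g k z|) (hQo k k.2).measurableSet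
          (fun z hz => by simp [hFQ k k.2 z hz])]
        exact setIntegral_le_integral (hgi k k.2).abs (Eventually.of_forall fun _ => abs_nonneg _)
    refine (integrableOn_iff_integrable_of_support_subset ?_).1 hon
    intro z hz
    by_contra h
    refine hz (hF0 z fun k hk hzk => h (Set.mem_iUnion.2 ⟨⟨k, hk⟩, hzk⟩))
  refine ⟨hFi, hs1, ?_, hs1.tsum_le_tsum (fun k => hgle k k.2) hs2, ?_⟩
  · simp only [hFabs]
    refine (integral_tsum_of_summable_integral_norm (F := fun (k : N) z => |g k z|)
      (fun k => (hgi k k.2).abs) ?_).symm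
    simpa using hs1
  · intro B γ k hk x hx
    obtain ⟨r, hr, hball⟩ := Metric.isOpen_iff.1 (hQo k hk) x hx
    refine limsup_congr ?_
    have hmem : {R ∈ rotSets B.sets γ x | Metric.diam R < r} ∈
        basisFilter (rotSets B.sets γ x) :=
      mem_iInf_of_mem (⟨r, hr⟩ : {r : ℝ // 0 < r}) (mem_principal_self _)
    filter_upwards [hmem] with R hR
    obtain ⟨⟨R0, hR0, rfl⟩, hd⟩ := hR
    have hlip : LipschitzWith 1 (fun y : ℂ => x + (γ : ℂ) * (y - x)) := by
      refine LipschitzWith.of_dist_le_mul fun y z => ?_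
      simp [dist_eq_norm, ← mul_sub, Circle.norm_coe]
    have hb := hlip.isBounded_image (B.bounded x R0 hR0)
    have hxR : x ∈ (fun y : ℂ => x + (γ : ℂ) * (y - x)) '' R0 :=
      ⟨x, B.mem_self x R0 hR0, by simp⟩
    have hsub : (fun y : ℂ => x + (γ : ℂ) * (y - x)) '' R0 ⊆ Q k := fun y hy =>
      hball (lt_of_le_of_lt (Metric.dist_le_diam_of_mem hb hy hxR) hd)
    have hae : F =ᵐ[volume.restrict ((fun y : ℂ => x + (γ : ℂ) * (y - x)) '' R0)] g k :=
      ae_mono (Measure.restrict_mono_set _ hsub)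
        ((ae_restrict_mem (hQo k hk).measurableSet).mono fun z hz => hFQ k hk z hz)
    simp only [avgI]
    rw [integral_congr_ae hae]

end
end
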